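/- arXiv:2605.21636 — 8 statements merged into one kernel-verified Lean document; each statement's English description precedes it below -/
import Mathlib

section
/- Every simplex of the incremental Delaunay complex has a unique smallest witness: for every σ ∈ Incr(γ) there exists a witness S(c*,r*) of σ such that every witness S(c,r) of σ satisfies r ≥ r*, and every witness of σ of radius r* has center c* (i.e., the minimum-radius witness is unique). -/
noncomputable section

attribute [local instance] Classical.propDecidable

/-- Euclidean space ℝ^d. -/
abbrev Pt (d : ℕ) := EuclideanSpace ℝ (Fin d)

variable {d : ℕ}

/-- The sphere with center `c` and radius `r` is a circumsphere of the finite set `Q`: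
every point of `Q` lies on it. -/
def OnSphere (c : Pt d) (r : ℝ) (Q : Finset (Pt d)) : Prop :=
  ∀ w ∈ Q, ‖w - c‖ = r

/-- The sphere with center `c` and radius `r` is `Z`-empty: no point of `Z` lies inside it. -/
def SphEmpty (c : Pt d) (r : ℝ) (Z : Finset (Pt d)) : Prop :=
  ∀ z ∈ Z, ¬ ‖z - c‖ < r

/-- The Delaunay triangulation of `Z`: nonempty subsets of `Z` admitting a `Z`-empty
circumsphere. -/
def DelT (Z : Finset (Pt d)) : Set (Finset (Pt d)) :=
  {σ | σ.Nonempty ∧ σ ⊆ Z ∧ ∃ c r, 0 ≤ r ∧ OnSphere c r σ ∧ SphEmpty c r Z}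

/-- `Z` is in general position: every nonempty subset `Q` of at most `d+1` points is affinely
independent, and no point of `Z \ Q` lies on the smallest circumsphere of `Q`. -/
def GenPos (Z : Finset (Pt d)) : Prop :=
  ∀ Q : Finset (Pt d), Q ⊆ Z → Q.Nonempty → Q.card ≤ d + 1 →
    (AffineIndependent ℝ (fun q : ↥(Q : Set (Pt d)) => (q : Pt d))) ∧
    ∀ c r, 0 ≤ r → OnSphere c r Q →
      (∀ c' r', 0 ≤ r' → OnSphere c' r' Q → r ≤ r') →
      ∀ z ∈ Z, z ∉ Q → ‖z - c‖ ≠ r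

/-- The sublevel set `X_p = {x ∈ X : γ(x) ≤ p}` (product order on `ℝ²`). -/
def Xsub (X : Finset (Pt d)) (γ : Pt d → ℝ × ℝ) (p : ℝ × ℝ) : Finset (Pt d) :=
  X.filter fun z => γ z ≤ p

/-- `x` is the point of `σ` with largest `γ₁`-value. -/
def IsMax1 (γ : Pt d → ℝ × ℝ) (σ : Finset (Pt d)) (x : Pt d) : Prop :=
  x ∈ σ ∧ ∀ z ∈ σ, (γ z).1 ≤ (γ x).1

/-- `y` is the point of `σ` with largest `γ₂`-value. -/
def IsMax2 (γ : Pt d → ℝ × ℝ) (σ : Finset (Pt d)) (y : Pt d) : Prop :=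
  y ∈ σ ∧ ∀ z ∈ σ, (γ z).2 ≤ (γ y).2

/-- The sphere of center `c` and radius `r` is a witness of `σ`, where `x = max₁(σ)` and
`y = max₂(σ)`: it is a circumsphere of `σ \ {x,y}`, `x` and `y` lie inside or on it, and it is
`(X_{γ(σ)} \ {x,y})`-empty (note `γ(σ) = (γ₁ x, γ₂ y)`). -/
def IsWitness (X : Finset (Pt d)) (γ : Pt d → ℝ × ℝ) (σ : Finset (Pt d))
    (x y c : Pt d) (r : ℝ) : Prop :=
  (∀ z ∈ σ, z ≠ x → z ≠ y → ‖z - c‖ = r) ∧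
  ‖x - c‖ ≤ r ∧ ‖y - c‖ ≤ r ∧
  ∀ w ∈ Xsub X γ ((γ x).1, (γ y).2), w ≠ x → w ≠ y → ¬ ‖w - c‖ < r

/-- The incremental Delaunay complex `Incr(γ)`: nonempty subsets of `X` admitting a witness. -/
def Incr (X : Finset (Pt d)) (γ : Pt d → ℝ × ℝ) : Set (Finset (Pt d)) :=
  {σ | σ.Nonempty ∧ σ ⊆ X ∧
    ∃ x y c r, IsMax1 γ σ x ∧ IsMax2 γ σ y ∧ 0 ≤ r ∧ IsWitness X γ σ x y c r}

/-- The incremental Delaunay radius `ω_σ`: the minimum radius of a witness of `σ`. -/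
def omegaRad (X : Finset (Pt d)) (γ : Pt d → ℝ × ℝ) (σ : Finset (Pt d)) : ℝ :=
  sInf {r | 0 ≤ r ∧ ∃ x y c, IsMax1 γ σ x ∧ IsMax2 γ σ y ∧ IsWitness X γ σ x y c r}

/-- `γ(σ)`: the coordinatewise maximum of `γ` over the nonempty finite set `σ`. -/
def gammaJoin (γ : Pt d → ℝ × ℝ) (σ : Finset (Pt d)) (h : σ.Nonempty) : ℝ × ℝ :=
  (σ.sup' h fun z => (γ z).1, σ.sup' h fun z => (γ z).2)

/-- `(σ, x)` is a conflict pair at `p ∈ Grid(γ)`: `σ` is a `d`-simplex of `DelT(X_p)`, `x` lies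
inside the circumsphere of `σ`, and either `p₁ < max(im γ₁)` and `x ∈ X_{p→}`, or
`p₂ < max(im γ₂)` and `x ∈ X_{p↑}` (the successor being expressed by its defining property). -/
def ConflictAt (X : Finset (Pt d)) (γ : Pt d → ℝ × ℝ) (p : ℝ × ℝ)
    (σ : Finset (Pt d)) (x : Pt d) : Prop :=
  p.1 ∈ X.image (fun z => (γ z).1) ∧ p.2 ∈ X.image (fun z => (γ z).2) ∧
  σ ∈ DelT (Xsub X γ p) ∧ σ.card = d + 1 ∧
  (∃ c r, 0 ≤ r ∧ OnSphere c r σ ∧ ‖x - c‖ < r) ∧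
  ((∃ a ∈ X.image (fun z => (γ z).1), p.1 < a ∧
      (∀ b ∈ X.image (fun z => (γ z).1), p.1 < b → a ≤ b) ∧
      x ∈ Xsub X γ (a, p.2)) ∨
   (∃ a ∈ X.image (fun z => (γ z).2), p.2 < a ∧
      (∀ b ∈ X.image (fun z => (γ z).2), p.2 < b → a ≤ b) ∧
      x ∈ Xsub X γ (p.1, a)))

/-- `(σ, x)` is a conflict pair: it is a conflict pair at some `p ∈ Grid(γ)`. -/
def ConflictPair (X : Finset (Pt d)) (γ : Pt d → ℝ × ℝ)
    (σ : Finset (Pt d)) (x : Pt d) : Prop :=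
  ∃ p, ConflictAt X γ p σ x

/-- `Δ` witnesses the Δ-property of `X`: `Δ` consists of `d+1` points of `X` which come first in
both the `γ₁`- and `γ₂`-orders, the two orders agree on `Δ`, and `X` is contained in the convex
hull of `Δ`. -/
def IsDelta (X : Finset (Pt d)) (γ : Pt d → ℝ × ℝ) (Δ : Finset (Pt d)) : Prop :=
  Δ ⊆ X ∧ Δ.card = d + 1 ∧
  (∀ a ∈ Δ, ∀ b ∈ X, b ∉ Δ → (γ a).1 < (γ b).1 ∧ (γ a).2 < (γ b).2) ∧
  (∀ a ∈ Δ, ∀ b ∈ Δ, ((γ a).1 ≤ (γ b).1 ↔ (γ a).2 ≤ (γ b).2)) ∧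
  (↑X : Set (Pt d)) ⊆ convexHull ℝ (↑Δ : Set (Pt d))

/-- The Voronoi cell of `x` with respect to `Y`. -/
def VorCell (x : Pt d) (Y : Set (Pt d)) : Set (Pt d) :=
  {w | ∀ y ∈ Y, ‖w - x‖ ≤ ‖w - y‖}

/-- The telescopic Voronoi cell `Tel(x)`: the closure of `⋃_{q ≥ γ(x)} Vor(x, X_q) × {q}`. -/
def Tel (X : Finset (Pt d)) (γ : Pt d → ℝ × ℝ) (x : Pt d) : Set (Pt d × (ℝ × ℝ)) :=
  closure {z | γ x ≤ z.2 ∧ z.1 ∈ VorCell x (↑(Xsub X γ z.2) : Set (Pt d))}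

/-- The telescopic Voronoi ball `TelVor(x)_{p,r}`. -/
def TelVor (X : Finset (Pt d)) (γ : Pt d → ℝ × ℝ) (x : Pt d) (p : ℝ × ℝ) (r : ℝ) :
    Set (Pt d × (ℝ × ℝ)) :=
  Tel X γ x ∩ {z | z.1 ∈ Metric.closedBall x r ∧ z.2 ≤ p}

/-- The telescopic Voronoi cell `TelVor(x)_{p,∞}`. -/
def TelVorInf (X : Finset (Pt d)) (γ : Pt d → ℝ × ℝ) (x : Pt d) (p : ℝ × ℝ) :
    Set (Pt d × (ℝ × ℝ)) :=
  Tel X γ x ∩ {z | z.2 ≤ p}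

/-- The radius of the smallest enclosing ball of `σ`. -/
def miniballRadius (σ : Finset (Pt d)) : ℝ :=
  sInf {r | 0 ≤ r ∧ ∃ c : Pt d, ∀ x ∈ σ, ‖x - c‖ ≤ r}

/-- The Delaunay radius `b_σ`: the minimum radius of a `Z`-empty circumsphere of `σ`. -/
def delRad (Z σ : Finset (Pt d)) : ℝ :=
  sInf {r | 0 ≤ r ∧ ∃ c, OnSphere c r σ ∧ SphEmpty c r Z}

/-- The telescopic offset `TelOffset_{p,r} ⊆ ℝ^d × ℝ²`. -/
def TelOffsetSet (X : Finset (Pt d)) (γ : Pt d → ℝ × ℝ) (p : ℝ × ℝ) (r : ℝ) :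
    Set (Pt d × (ℝ × ℝ)) :=
  ⋃ x ∈ X, Metric.closedBall x r ×ˢ {q : ℝ × ℝ | γ x ≤ q ∧ q ≤ p}

/-- The sublevel offset `Offset_{p,r} ⊆ ℝ^d`. -/
def OffsetSet (X : Finset (Pt d)) (γ : Pt d → ℝ × ℝ) (p : ℝ × ℝ) (r : ℝ) : Set (Pt d) :=
  ⋃ x ∈ Xsub X γ p, Metric.closedBall x r

/-- `OU_r = ⋃_{x ∈ X} Ball_r(x) × Vor(x,X) ⊆ ℝ^d × ℝ^d`. -/
def OUSet (X : Finset (Pt d)) (r : ℝ) : Set (Pt d × Pt d) :=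
  ⋃ x ∈ X, Metric.closedBall x r ×ˢ VorCell x (↑X : Set (Pt d))

/-- `Offset(X)_r = ⋃_{x ∈ X} Ball_r(x) ⊆ ℝ^d`. -/
def OffsetR (X : Finset (Pt d)) (r : ℝ) : Set (Pt d) :=
  ⋃ x ∈ X, Metric.closedBall x r

/-- `OTelDC_{p,r} ⊆ ℝ^d × ℝ^d × ℝ²`. -/
def OTelDCSet (X : Finset (Pt d)) (γ : Pt d → ℝ × ℝ) (p : ℝ × ℝ) (r : ℝ) :
    Set (Pt d × Pt d × (ℝ × ℝ)) :=
  {z | z.2.2 ≤ p ∧ ∃ x ∈ Xsub X γ z.2.2,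
    ‖x - z.1‖ ≤ r ∧ z.2.1 ∈ VorCell x (↑(Xsub X γ z.2.2) : Set (Pt d))}

/-- The squared distance from the midpoint of `a` and `b`, by the theorem of Apollonius. -/
lemma norm_sub_midpoint_sq (z a b : Pt d) :
    ‖z - midpoint ℝ a b‖ ^ 2 = (‖z - a‖ ^ 2 + ‖z - b‖ ^ 2) / 2 - ‖a - b‖ ^ 2 / 4 := by
  have h := EuclideanGeometry.dist_sq_add_dist_sq_eq_two_mul_dist_midpoint_sq_add_half_dist_sq z a b
  simp only [dist_eq_norm] at h
  linarith

lemma isClosed_setOf_isWitness (X : Finset (Pt d)) (γ : Pt d → ℝ × ℝ) (σ : Finset (Pt d))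
    (x y : Pt d) : IsClosed {q : Pt d × ℝ | IsWitness X γ σ x y q.1 q.2} := by
  simp only [IsWitness, Set.ofPred_and, Set.ofPred_forall, not_lt]
  refine IsClosed.inter ?_ (IsClosed.inter ?_ (IsClosed.inter ?_ ?_))
  · exact isClosed_iInter fun z => isClosed_iInter fun _ => isClosed_iInter fun _ =>
      isClosed_iInter fun _ => isClosed_eq (by fun_prop) (by fun_prop)
  · exact isClosed_le (by fun_prop) (by fun_prop)
  · exact isClosed_le (by fun_prop) (by fun_prop)
  · exact isClosed_iInter fun z => isClosed_iInter fun _ => isClosed_iInter fun _ =>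
      isClosed_iInter fun _ => isClosed_le (by fun_prop) (by fun_prop)

/-- If a simplex has a witness, it has one of minimum radius. -/
lemma IsWitness.exists_minimal {X : Finset (Pt d)} {γ : Pt d → ℝ × ℝ} {σ : Finset (Pt d)}
    {x y c : Pt d} {r : ℝ} (h : IsWitness X γ σ x y c r) :
    ∃ c₀ r₀, IsWitness X γ σ x y c₀ r₀ ∧ ∀ c' r', IsWitness X γ σ x y c' r' → r₀ ≤ r' := by
  set K : Set (Pt d × ℝ) :=
    {q | IsWitness X γ σ x y q.1 q.2} ∩ (Metric.closedBall x r ×ˢ Set.Icc 0 r)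
  have hK : IsCompact K :=
    ((isCompact_closedBall x r).prod isCompact_Icc).inter_left (isClosed_setOf_isWitness X γ σ x y)
  have mem_K : ∀ c' r', IsWitness X γ σ x y c' r' → r' ≤ r → (c', r') ∈ K := by
    intro c' r' h' hr
    refine ⟨h', ?_, (norm_nonneg _).trans h'.2.1, hr⟩
    rw [Metric.mem_closedBall', dist_eq_norm]
    exact h'.2.1.trans hr
  obtain ⟨q, hq, hmin⟩ := hK.exists_isMinOn ⟨_, mem_K c r h le_rfl⟩ continuous_snd.continuousOn
  refine ⟨q.1, q.2, hq.1, fun c' r' h' => ?_⟩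
  rcases le_total r' r with hr | hr
  · exact hmin (mem_K c' r' h' hr)
  · exact hq.2.2.2.trans hr

/-- Two witnesses of equal radius yield a witness centered at the midpoint of their centers. -/
lemma IsWitness.midpoint {X : Finset (Pt d)} {γ : Pt d → ℝ × ℝ} {σ : Finset (Pt d)}
    {x y a b : Pt d} {r : ℝ} (ha : IsWitness X γ σ x y a r) (hb : IsWitness X γ σ x y b r) :
    IsWitness X γ σ x y (midpoint ℝ a b) √(r ^ 2 - ‖a - b‖ ^ 2 / 4) := by
  obtain ⟨ha_on, hax, hay, ha_empty⟩ := ha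
  obtain ⟨hb_on, hbx, hby, hb_empty⟩ := hb
  have hr : 0 ≤ r := (norm_nonneg _).trans hax
  have inside : ∀ z : Pt d, ‖z - a‖ ≤ r → ‖z - b‖ ≤ r →
      ‖z - _root_.midpoint ℝ a b‖ ≤ √(r ^ 2 - ‖a - b‖ ^ 2 / 4) := by
    intro z hza hzb
    apply Real.le_sqrt_of_sq_le
    rw [norm_sub_midpoint_sq]
    have := pow_le_pow_left₀ (norm_nonneg _) hza 2
    have := pow_le_pow_left₀ (norm_nonneg _) hzb 2
    linarith
  have outside : ∀ z : Pt d, r ≤ ‖z - a‖ → r ≤ ‖z - b‖ →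
      √(r ^ 2 - ‖a - b‖ ^ 2 / 4) ≤ ‖z - _root_.midpoint ℝ a b‖ := by
    intro z hza hzb
    rw [Real.sqrt_le_left (norm_nonneg _), norm_sub_midpoint_sq]
    have := pow_le_pow_left₀ hr hza 2
    have := pow_le_pow_left₀ hr hzb 2
    linarith
  refine ⟨fun z hz hzx hzy => ?_, inside x hax hbx, inside y hay hby, fun w hw hwx hwy => ?_⟩
  · have hza := ha_on z hz hzx hzy
    have hzb := hb_on z hz hzx hzy
    exact le_antisymm (inside z hza.le hzb.le) (outside z hza.ge hzb.ge)
  · exact not_lt.2 (outside w (not_lt.1 (ha_empty w hw hwx hwy)) (not_lt.1 (hb_empty w hw hwx hwy)))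

/-- Every simplex of the incremental Delaunay complex has a unique smallest
witness. -/
theorem uniqueSmallestWitness
    {d : ℕ} (hd : 1 ≤ d) (X : Finset (Pt d)) (γ : Pt d → ℝ × ℝ)
    (hgen : GenPos X)
    (hinj1 : Set.InjOn (fun z => (γ z).1) (↑X : Set (Pt d)))
    (hinj2 : Set.InjOn (fun z => (γ z).2) (↑X : Set (Pt d)))
    (σ : Finset (Pt d)) (hσ : σ ∈ Incr X γ)
    (x y : Pt d) (hx : IsMax1 γ σ x) (hy : IsMax2 γ σ y) :
    ∃ c₀ : Pt d, ∃ r₀ : ℝ, 0 ≤ r₀ ∧ IsWitness X γ σ x y c₀ r₀ ∧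
      (∀ c : Pt d, ∀ r : ℝ, 0 ≤ r → IsWitness X γ σ x y c r → r₀ ≤ r) ∧
      (∀ c : Pt d, IsWitness X γ σ x y c r₀ → c = c₀) := by
  obtain ⟨-, hσX, x', y', c, r, hx', hy', -, hw⟩ := hσ
  obtain rfl : x' = x :=
    hinj1 (hσX hx'.1) (hσX hx.1) (le_antisymm (hx.2 _ hx'.1) (hx'.2 _ hx.1))
  obtain rfl : y' = y :=
    hinj2 (hσX hy'.1) (hσX hy.1) (le_antisymm (hy.2 _ hy'.1) (hy'.2 _ hy.1))
  obtain ⟨c₀, r₀, h₀, hmin⟩ := hw.exists_minimal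
  have hr₀ : 0 ≤ r₀ := (norm_nonneg _).trans h₀.2.1
  refine ⟨c₀, r₀, hr₀, h₀, fun c r _ h => hmin c r h, fun c h => ?_⟩
  have hmid := h.midpoint h₀
  by_contra hne
  have hpos : 0 < ‖c - c₀‖ := norm_pos_iff.2 (sub_ne_zero.2 hne)
  rcases hr₀.eq_or_lt with rfl | hr₀
  · have hxc := norm_le_zero_iff.1 h.2.1
    have hxc₀ := norm_le_zero_iff.1 h₀.2.1
    exact hne ((sub_eq_zero.1 hxc).symm.trans (sub_eq_zero.1 hxc₀))
  · have hlt : √(r₀ ^ 2 - ‖c - c₀‖ ^ 2 / 4) < r₀ := by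
      rw [Real.sqrt_lt' hr₀]
      linarith [pow_pos hpos 2]
    exact (hmin _ _ hmid).not_gt hlt
end
end

section
/- Let σ ∈ Incr(γ) with |σ| = 2 and max₁(σ) ≠ max₂(σ). Then the minimum-radius witness of σ is a circumsphere of σ (both points of σ lie on it); in particular, σ belongs to the Delaunay triangulation DelT(X_{γ(σ)}). -/
noncomputable section

attribute [local instance] Classical.propDecidable

variable {d : ℕ}

/-- A closed ball containing `a`, and `b` in its interior, contains a strictly smaller ball which
still contains both `a` and `b`. -/
lemma exists_smaller_ball_of_norm_sub_lt {E : Type*} [NormedAddCommGroup E] [NormedSpace ℝ E]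
    {a b c : E} {r : ℝ} (ha : ‖a - c‖ ≤ r) (hb : ‖b - c‖ < r) :
    ∃ c' r', 0 ≤ r' ∧ r' < r ∧ ‖a - c'‖ ≤ r' ∧ ‖b - c'‖ ≤ r' ∧
      ∀ w, ‖w - c'‖ < r' → ‖w - c‖ < r := by
  have hb0 := norm_nonneg (b - c)
  have hr : 0 < r := hb0.trans_lt hb
  obtain ⟨t, ht⟩ : ∃ t : ℝ, t = (r - ‖b - c‖) / (2 * r) := ⟨_, rfl⟩
  have htr : t * r = (r - ‖b - c‖) / 2 := by rw [ht]; field_simp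
  have ht0 : 0 < t := by rw [ht]; exact div_pos (by linarith) (by linarith)
  have ht1 : t ≤ 1 := by rw [ht, div_le_one (by linarith)]; linarith
  have hshift : ‖t • (a - c)‖ ≤ t * r := by
    rw [norm_smul, Real.norm_of_nonneg ht0.le]
    exact mul_le_mul_of_nonneg_left ha ht0.le
  refine ⟨c + t • (a - c), (1 - t) * r, mul_nonneg (by linarith) hr.le, by nlinarith, ?_, ?_, ?_⟩
  · have h : a - (c + t • (a - c)) = (1 - t) • (a - c) := by module
    rw [h, norm_smul, Real.norm_of_nonneg (by linarith)]
    exact mul_le_mul_of_nonneg_left ha (by linarith)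
  · have h := norm_sub_le (b - c) (t • (a - c))
    rw [sub_sub] at h
    linarith
  · intro w hw
    have h := norm_add_le (w - (c + t • (a - c))) (t • (a - c))
    rw [show w - (c + t • (a - c)) + t • (a - c) = w - c by module] at h
    linarith

/-- For `σ ∈ Incr(γ)` with `|σ| = 2` and `max₁(σ) ≠ max₂(σ)`, the minimum-radius
witness of `σ` is a circumsphere of `σ`; in particular `σ ∈ DelT(X_{γ(σ)})`. -/
theorem minWitnessCircumsphereOfPair
    {d : ℕ} (hd : 1 ≤ d) (X : Finset (Pt d)) (γ : Pt d → ℝ × ℝ)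
    (hgen : GenPos X)
    (hinj1 : Set.InjOn (fun z => (γ z).1) (↑X : Set (Pt d)))
    (hinj2 : Set.InjOn (fun z => (γ z).2) (↑X : Set (Pt d)))
    (σ : Finset (Pt d)) (hσ : σ ∈ Incr X γ) (hcard : σ.card = 2)
    (x y : Pt d) (hx : IsMax1 γ σ x) (hy : IsMax2 γ σ y) (hxy : x ≠ y)
    (c : Pt d) (r : ℝ) (hr : 0 ≤ r) (hwit : IsWitness X γ σ x y c r)
    (hmin : ∀ c' : Pt d, ∀ r' : ℝ, 0 ≤ r' → IsWitness X γ σ x y c' r' → r ≤ r') :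
    (∀ z ∈ σ, ‖z - c‖ = r) ∧ σ ∈ DelT (Xsub X γ ((γ x).1, (γ y).2)) := by
  obtain ⟨-, hσX, -⟩ := hσ
  obtain rfl : σ = {x, y} := by
    refine (Finset.eq_of_subset_of_card_le ?_ ?_).symm
    · intro z hz
      rcases Finset.mem_insert.1 hz with rfl | hz
      · exact hx.1
      · rw [Finset.mem_singleton.1 hz]; exact hy.1
    · rw [hcard, Finset.card_pair hxy]
  obtain ⟨-, hxc, hyc, hempty⟩ := hwit
  have hpair : ∀ z ∈ ({x, y} : Finset (Pt d)), z = x ∨ z = y := fun z hz => by simpa using hz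
  have hrigid : ∀ c' r', 0 ≤ r' → r' < r → ‖x - c'‖ ≤ r' → ‖y - c'‖ ≤ r' →
      ¬ ∀ w, ‖w - c'‖ < r' → ‖w - c‖ < r := by
    intro c' r' h0 hlt hxc' hyc' hsub
    refine absurd (hmin c' r' h0 ⟨fun z hz hzx hzy => ?_, hxc', hyc', fun w hw hwx hwy hwr =>
      hempty w hw hwx hwy (hsub w hwr)⟩) hlt.not_ge
    exact ((hpair z hz).elim hzx hzy).elim
  have hxr : ‖x - c‖ = r := by
    by_contra hne
    obtain ⟨c', r', h0, hlt, hy', hx', hsub⟩ :=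
      exists_smaller_ball_of_norm_sub_lt hyc (lt_of_le_of_ne hxc hne)
    exact hrigid c' r' h0 hlt hx' hy' hsub
  have hyr : ‖y - c‖ = r := by
    by_contra hne
    obtain ⟨c', r', h0, hlt, hx', hy', hsub⟩ :=
      exists_smaller_ball_of_norm_sub_lt hxc (lt_of_le_of_ne hyc hne)
    exact hrigid c' r' h0 hlt hx' hy' hsub
  have hon : ∀ z ∈ ({x, y} : Finset (Pt d)), ‖z - c‖ = r := by
    intro z hz
    rcases hpair z hz with rfl | rfl
    · exact hxr
    · exact hyr
  refine ⟨hon, ⟨x, hx.1⟩, fun z hz => ?_, c, r, hr, hon, fun w hw => ?_⟩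
  · exact Finset.mem_filter.2 ⟨hσX hz, hx.2 z hz, hy.2 z hz⟩
  · by_cases hwx : w = x
    · rw [hwx]; exact hxr.not_lt
    by_cases hwy : w = y
    · rw [hwy]; exact hyr.not_lt
    exact hempty w hw hwx hwy
end
end

section
/- Let p ∈ ℝ² and r ≥ 0, and let σ ⊆ X_p be nonempty. If σ admits an X_p-empty circumsphere of radius at most r, then σ ∈ Incr(γ), γ(σ) ≤ p, and the incremental Delaunay radius ω_σ is at most r. -/
noncomputable section

attribute [local instance] Classical.propDecidable

variable {d : ℕ}

/-- If a nonempty `σ ⊆ X_p` admits an `X_p`-empty circumsphere of radius at most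
`r`, then `σ ∈ Incr(γ)`, `γ(σ) ≤ p`, and `ω_σ ≤ r`. -/
theorem incrOfEmptyCircumsphere
    {d : ℕ} (hd : 1 ≤ d) (X : Finset (Pt d)) (γ : Pt d → ℝ × ℝ)
    (hgen : GenPos X)
    (hinj1 : Set.InjOn (fun z => (γ z).1) (↑X : Set (Pt d)))
    (hinj2 : Set.InjOn (fun z => (γ z).2) (↑X : Set (Pt d)))
    (p : ℝ × ℝ) (r : ℝ) (hr : 0 ≤ r)
    (σ : Finset (Pt d)) (hne : σ.Nonempty) (hsub : σ ⊆ Xsub X γ p)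
    (h : ∃ c : Pt d, ∃ r' : ℝ, 0 ≤ r' ∧ r' ≤ r ∧ OnSphere c r' σ ∧ SphEmpty c r' (Xsub X γ p)) :
    σ ∈ Incr X γ ∧ gammaJoin γ σ hne ≤ p ∧ omegaRad X γ σ ≤ r := by
  obtain ⟨c, r', hr', hle, hon, hemp⟩ := h
  obtain ⟨x, hx, hxmax⟩ := σ.exists_max_image (fun z => (γ z).1) hne
  obtain ⟨y, hy, hymax⟩ := σ.exists_max_image (fun z => (γ z).2) hne
  have hp : ∀ z ∈ σ, γ z ≤ p := fun z hz => (Finset.mem_filter.mp (hsub hz)).2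
  have hwit : IsWitness X γ σ x y c r' := by
    refine ⟨fun z hz _ _ => hon z hz, (hon x hx).le, (hon y hy).le, fun w hw _ _ => ?_⟩
    obtain ⟨hwX, hwle⟩ := Finset.mem_filter.mp hw
    exact hemp w (Finset.mem_filter.mpr ⟨hwX, hwle.trans ⟨(hp x hx).1, (hp y hy).2⟩⟩)
  refine ⟨⟨hne, hsub.trans (Finset.filter_subset _ _),
    x, y, c, r', ⟨hx, hxmax⟩, ⟨hy, hymax⟩, hr', hwit⟩, ⟨?_, ?_⟩, ?_⟩
  · exact Finset.sup'_le hne _ fun z hz => (hp z hz).1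
  · exact Finset.sup'_le hne _ fun z hz => (hp z hz).2
  · refine le_trans (csInf_le ⟨0, fun _ hs => hs.1⟩ ?_) hle
    exact ⟨hr', x, y, c, ⟨hx, hxmax⟩, ⟨hy, hymax⟩, hwit⟩
end
end

section
/- If (σ,x) and (σ,y) are conflict pairs with x ≠ y, then γ(x) and γ(y) are incomparable in the product partial order on ℝ² (neither γ(x) ≤ γ(y) nor γ(y) ≤ γ(x)). -/
noncomputable section

attribute [local instance] Classical.propDecidable

variable {d : ℕ}

/-- A set of `d + 1` affinely independent points in `ℝ^d` has at most one circumsphere. -/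
theorem OnSphere.unique {d : ℕ} {σ : Finset (Pt d)} {c c' : Pt d} {r r' : ℝ}
    (hcard : σ.card = d + 1)
    (hind : AffineIndependent ℝ (fun q : ↥(σ : Set (Pt d)) => (q : Pt d)))
    (h : OnSphere c r σ) (h' : OnSphere c' r' σ) : c = c' ∧ r = r' := by
  have hspan : vectorSpan ℝ (σ : Set (Pt d)) = ⊤ := by
    have := hind.vectorSpan_eq_top_of_card_eq_finrank_add_one (by simp [hcard])
    simpa using this
  have horth : vectorSpan ℝ (σ : Set (Pt d)) ≤ (ℝ ∙ (c' - c))ᗮ := by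
    refine Submodule.span_le.2 ?_
    rintro _ ⟨a, ha, b, hb, rfl⟩
    refine Submodule.mem_orthogonal_singleton_iff_inner_right.2 ?_
    exact EuclideanGeometry.inner_vsub_vsub_of_dist_eq_of_dist_eq
      (c₁ := c) (c₂ := c') (p₁ := b) (p₂ := a)
      (by rw [dist_eq_norm, dist_eq_norm, h b hb, h a ha])
      (by rw [dist_eq_norm, dist_eq_norm, h' b hb, h' a ha])
  have hmem : c' - c ∈ (ℝ ∙ (c' - c))ᗮ := horth (hspan ▸ Submodule.mem_top)
  have hc : c = c' :=
    (sub_eq_zero.1 (inner_self_eq_zero.1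
      (Submodule.mem_orthogonal_singleton_iff_inner_right.1 hmem))).symm
  subst hc
  obtain ⟨w, hw⟩ : σ.Nonempty := Finset.card_pos.1 (by omega)
  exact ⟨rfl, (h w hw).symm.trans (h' w hw)⟩

/-- Two conflict pairs of the same simplex with comparable `γ`-values coincide. -/
theorem ConflictPair.eq_of_le {d : ℕ} {X : Finset (Pt d)} {γ : Pt d → ℝ × ℝ}
    (hgen : GenPos X)
    (hinj1 : Set.InjOn (fun z => (γ z).1) (↑X : Set (Pt d)))
    (hinj2 : Set.InjOn (fun z => (γ z).2) (↑X : Set (Pt d)))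
    {σ : Finset (Pt d)} {x y : Pt d}
    (hx : ConflictPair X γ σ x) (hy : ConflictPair X γ σ y) (hle : γ x ≤ γ y) : x = y := by
  obtain ⟨p, -, -, -, -, ⟨c, r, -, hc, hxc⟩, hxp⟩ := hx
  obtain ⟨q, -, -, ⟨hne, hsub, c', r', -, hc', hempty⟩, hcard, -, hyq⟩ := hy
  have hxX : x ∈ X := by
    rcases hxp with ⟨_, -, -, -, h⟩ | ⟨_, -, -, -, h⟩ <;> exact (Finset.mem_filter.1 h).1
  have hind := (hgen σ (hsub.trans (Finset.filter_subset _ _)) hne hcard.le).1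
  obtain ⟨rfl, rfl⟩ := hc.unique hcard hind hc'
  have hxq : ¬ γ x ≤ q := fun h => hempty x (Finset.mem_filter.2 ⟨hxX, h⟩) hxc
  rcases hyq with ⟨a, -, -, hmin, hya⟩ | ⟨a, -, -, hmin, hya⟩ <;>
    obtain ⟨hyX, hy1, hy2⟩ := Finset.mem_filter.1 hya
  · have hlt : q.1 < (γ x).1 := not_le.1 fun h => hxq ⟨h, hle.2.trans hy2⟩
    exact hinj1 hxX hyX
      (le_antisymm hle.1 (hy1.trans (hmin _ (Finset.mem_image_of_mem _ hxX) hlt)))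
  · have hlt : q.2 < (γ x).2 := not_le.1 fun h => hxq ⟨hle.1.trans hy1, h⟩
    exact hinj2 hxX hyX
      (le_antisymm hle.2 (hy2.trans (hmin _ (Finset.mem_image_of_mem _ hxX) hlt)))

/-- If `(σ,x)` and `(σ,y)` are conflict pairs with `x ≠ y`, then `γ(x)` and `γ(y)`
are incomparable in the product order on `ℝ²`. -/
theorem conflictPairsIncomparable
    {d : ℕ} (hd : 1 ≤ d) (X : Finset (Pt d)) (γ : Pt d → ℝ × ℝ)
    (hgen : GenPos X)
    (hinj1 : Set.InjOn (fun z => (γ z).1) (↑X : Set (Pt d)))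
    (hinj2 : Set.InjOn (fun z => (γ z).2) (↑X : Set (Pt d)))
    (σ : Finset (Pt d)) (x y : Pt d)
    (hx : ConflictPair X γ σ x) (hy : ConflictPair X γ σ y) (hxy : x ≠ y) :
    ¬ γ x ≤ γ y ∧ ¬ γ y ≤ γ x := by
  exact ⟨fun h => hxy (hx.eq_of_le hgen hinj1 hinj2 hy h),
    fun h => hxy (hy.eq_of_le hgen hinj1 hinj2 hx h).symm⟩
end
end

section
/- Let σ be such that T_σ is nonempty and let x, y ∈ T_σ with γ₁(x) < γ₁(y). Then there exists p ∈ Grid(γ) at which both (σ,x) and (σ,y) are conflict pairs (i.e., (σ,x,y) is a conflict triple) if and only if there is no z ∈ T_σ with γ₁(x) < γ₁(z) < γ₁(y). -/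
noncomputable section

attribute [local instance] Classical.propDecidable

variable {d : ℕ}

/-- An affinely independent set of `d + 1` points of `ℝ^d` has at most one circumsphere. -/
lemma OnSphere.eq_of_affineIndependent {d : ℕ} {σ : Finset (Pt d)}
    (hind : AffineIndependent ℝ (fun q : ↥(σ : Set (Pt d)) => (q : Pt d)))
    (hcard : σ.card = d + 1) {c c' : Pt d} {r r' : ℝ}
    (h : OnSphere c r σ) (h' : OnSphere c' r' σ) : c = c' ∧ r = r' := by
  have hne : σ.Nonempty := Finset.card_pos.mp (by omega)
  have : Nonempty ↥(σ : Set (Pt d)) := hne.to_subtype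
  have htop : affineSpan ℝ (Set.range fun q : ↥(σ : Set (Pt d)) => (q : Pt d)) = ⊤ := by
    rw [hind.affineSpan_eq_top_iff_card_eq_finrank_add_one]
    simp [hcard]
  obtain ⟨S, -, hS⟩ := hind.existsUnique_dist_eq
  have sphere_eq : ∀ {c : Pt d} {r : ℝ}, OnSphere c r σ →
      (⟨c, r⟩ : EuclideanGeometry.Sphere (Pt d)) = S := by
    intro c r h
    refine hS _ ⟨by rw [htop]; trivial, ?_⟩
    rintro _ ⟨q, rfl⟩
    simpa [EuclideanGeometry.mem_sphere, dist_eq_norm] using h q q.2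
  simpa using (sphere_eq h).trans (sphere_eq h').symm

/-- The order-theoretic content of a conflict pair: `(p, q)` is a grid point above `(s, t)`, no
point of `B` lies below it, and the point `x` of `B` enters at the next column or row. -/
def StairConflict {α : Type*} (X B : Finset α) (f g : α → ℝ) (s t p q : ℝ) (x : α) : Prop :=
  p ∈ X.image f ∧ q ∈ X.image g ∧ s ≤ p ∧ t ≤ q ∧ (∀ w ∈ B, f w ≤ p → ¬ g w ≤ q) ∧ x ∈ B ∧
  ((p < f x ∧ (∀ b ∈ X, p < f b → f x ≤ f b) ∧ g x ≤ q) ∨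
   (q < g x ∧ (∀ b ∈ X, q < g b → g x ≤ g b) ∧ f x ≤ p))

/-- `x` is the only point of `B` whose join with `(s, t)` is at most that of `x`. -/
def StairMinimal {α : Type*} (B : Finset α) (f g : α → ℝ) (s t : ℝ) (x : α) : Prop :=
  x ∈ B ∧ ∀ w ∈ B, max (f w) s ≤ max (f x) s → max (g w) t ≤ max (g x) t → w = x

section Staircase

variable {α : Type*} {X B : Finset α} {f g : α → ℝ} {s t p q : ℝ} {x y : α}

lemma StairConflict.swap (h : StairConflict X B f g s t p q x) :
    StairConflict X B g f t s q p x := by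
  obtain ⟨h1, h2, h3, h4, h5, h6, h7⟩ := h
  exact ⟨h2, h1, h4, h3, fun w hw hg hf => h5 w hw hf hg, h6, h7.symm⟩

lemma StairMinimal.swap (h : StairMinimal B f g s t x) : StairMinimal B g f t s x :=
  ⟨h.1, fun w hw hg hf => h.2 w hw hf hg⟩

lemma exists_pred_mem_image (hs : s ∈ X.image f) (h : s < f x) :
    ∃ p ∈ X.image f, s ≤ p ∧ p < f x ∧ (∀ b ∈ X, p < f b → f x ≤ f b) ∧
      ∀ b ∈ X.image f, b < f x → b ≤ p := by
  have hne : ((X.image f).filter (· < f x)).Nonempty :=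
    ⟨s, Finset.mem_filter.mpr ⟨hs, h⟩⟩
  have hmem := Finset.mem_filter.mp (Finset.max'_mem _ hne)
  have hle : ∀ b ∈ X.image f, b < f x → b ≤ ((X.image f).filter (· < f x)).max' hne :=
    fun b hb hlt => Finset.le_max' _ _ (Finset.mem_filter.mpr ⟨hb, hlt⟩)
  refine ⟨_, hmem.1, hle s hs h, hmem.2, fun b hb hlt => ?_, hle⟩
  by_contra! hcon
  exact absurd (hle _ (Finset.mem_image_of_mem f hb) hcon) (not_le.mpr hlt)

lemma StairConflict.stairMinimal (hB : B ⊆ X) (hf : Set.InjOn f X) (hg : Set.InjOn g X)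
    (h : StairConflict X B f g s t p q x) : StairMinimal B f g s t x := by
  have column : ∀ {f g : α → ℝ} {s t p q : ℝ}, Set.InjOn f X → s ≤ p → t ≤ q →
      (∀ w ∈ B, f w ≤ p → ¬ g w ≤ q) → x ∈ B → p < f x →
      (∀ b ∈ X, p < f b → f x ≤ f b) → g x ≤ q → StairMinimal B f g s t x := by
    intro f g s t p q hf hs ht hemp hx hpx hsucc hgx
    refine ⟨hx, fun w hw h1 h2 => ?_⟩
    have hgw : g w ≤ q := (le_max_left _ _).trans (h2.trans (max_le hgx ht))
    have hfw : p < f w := not_le.mp fun hle => hemp w hw hle hgw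
    rw [max_eq_left (hs.trans hpx.le)] at h1
    exact hf (hB hw) (hB hx) (le_antisymm ((le_max_left _ _).trans h1) (hsucc w (hB hw) hfw))
  obtain ⟨-, -, hs, ht, hemp, hx, ⟨h1, h2, h3⟩ | ⟨h1, h2, h3⟩⟩ := h
  · exact column hf hs ht hemp hx h1 h2 h3
  · exact (column hg ht hs (fun w hw hg hf => hemp w hw hf hg) hx h1 h2 h3).swap

lemma StairMinimal.exists_stairConflict (hB : B ⊆ X) (hs : s ∈ X.image f) (ht : t ∈ X.image g)
    (hemp : ∀ w ∈ B, f w ≤ s → ¬ g w ≤ t) (h : StairMinimal B f g s t x) :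
    ∃ p q, StairConflict X B f g s t p q x := by
  have column : ∀ {f g : α → ℝ} {s t : ℝ}, s ∈ X.image f → t ∈ X.image g →
      StairMinimal B f g s t x → s < f x → ∃ p q, StairConflict X B f g s t p q x := by
    intro f g s t hs ht h hlt
    obtain ⟨p, hp, hsp, hpx, hsucc, -⟩ := exists_pred_mem_image hs hlt
    refine ⟨p, max (g x) t, hp, ?_, hsp, le_max_right _ _, fun w hw h1 h2 => ?_, h.1,
      Or.inl ⟨hpx, hsucc, le_max_left _ _⟩⟩
    · rcases max_choice (g x) t with e | e <;> rw [e]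
      exacts [Finset.mem_image_of_mem g (hB h.1), ht]
    · have := h.2 w hw (max_le_max_right _ (h1.trans hpx.le)) (max_le h2 (le_max_right _ _))
      subst this
      exact absurd h1 (not_le.mpr hpx)
  rcases lt_or_ge s (f x) with h1 | h1
  · exact column hs ht h h1
  · obtain ⟨p, q, hpq⟩ := column ht hs h.swap (not_le.mp (hemp x h.1 h1))
    exact ⟨q, p, hpq.swap⟩

/-- Below any point of `B` there is a minimal one, with respect to joins with `(s, t)`. -/
lemma exists_stairMinimal_le (hB : B ⊆ X) (hf : Set.InjOn f X) (hg : Set.InjOn g X)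
    (hemp : ∀ w ∈ B, f w ≤ s → ¬ g w ≤ t) (hx : x ∈ B) :
    ∃ z, StairMinimal B f g s t z ∧ max (f z) s ≤ max (f x) s ∧ max (g z) t ≤ max (g x) t := by
  let S := B.filter fun w => max (f w) s ≤ max (f x) s ∧ max (g w) t ≤ max (g x) t
  obtain ⟨z, hzS, hz⟩ := S.exists_min_image (fun w => max (f w) s + max (g w) t)
    ⟨x, Finset.mem_filter.mpr ⟨hx, le_rfl, le_rfl⟩⟩
  obtain ⟨hzB, hz1, hz2⟩ := Finset.mem_filter.mp hzS
  refine ⟨z, ⟨hzB, fun w hw h1 h2 => ?_⟩, hz1, hz2⟩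
  have hsum := hz w (Finset.mem_filter.mpr ⟨hw, h1.trans hz1, h2.trans hz2⟩)
  have e1 : max (f w) s = max (f z) s := by linarith
  have e2 : max (g w) t = max (g z) t := by linarith
  rcases lt_or_ge s (f z) with h | h
  · refine hf (hB hw) (hB hzB) ?_
    grind
  · have h' := not_le.mp (hemp z hzB h)
    refine hg (hB hw) (hB hzB) ?_
    grind

lemma StairConflict.not_between (hB : B ⊆ X) (hg : Set.InjOn g X)
    (hx : StairConflict X B f g s t p q x) (hy : StairConflict X B f g s t p q y)
    (hxy : f x < f y) {z : α} (hz : StairMinimal B f g s t z) (hxz : f x < f z) :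
    ¬ f z < f y := by
  intro hzy
  obtain ⟨-, -, hs, ht, hemp, hxB, hx⟩ := hx
  obtain ⟨-, -, -, -, -, hyB, hy⟩ := hy
  rcases hx with ⟨hx1, hx2, hx3⟩ | ⟨hx1, hx2, hx3⟩
  · rcases hy with ⟨hy1, hy2, hy3⟩ | ⟨hy1, hy2, hy3⟩
    · exact absurd (hy2 x (hB hxB) hx1) (not_le.mpr hxy)
    · linarith
  · rcases hy with ⟨hy1, hy2, hy3⟩ | ⟨hy1, hy2, hy3⟩
    · have hzp : f z ≤ p := not_lt.mp fun h => absurd (hy2 z (hB hz.1) h) (not_le.mpr hzy)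
      have hgz := hx2 z (hB hz.1) (not_le.mp (hemp z hz.1 hzp))
      have := hz.2 x hxB (max_le_max_right _ hxz.le) (max_le_max_right _ hgz)
      exact absurd (this ▸ hxz) (lt_irrefl _)
    · have := hg (hB hxB) (hB hyB) (le_antisymm (hx2 y (hB hyB) hy1) (hy2 x (hB hxB) hx1))
      exact absurd (this ▸ hxy) (lt_irrefl _)

lemma StairMinimal.exists_common_stairConflict (hB : B ⊆ X) (hf : Set.InjOn f X)
    (hg : Set.InjOn g X) (hs : s ∈ X.image f) (ht : t ∈ X.image g)
    (hemp : ∀ w ∈ B, f w ≤ s → ¬ g w ≤ t)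
    (hx : StairMinimal B f g s t x) (hy : StairMinimal B f g s t y) (hxy : f x < f y)
    (hbetween : ∀ z, StairMinimal B f g s t z → f x < f z → ¬ f z < f y) :
    ∃ p q, StairConflict X B f g s t p q x ∧ StairConflict X B f g s t p q y := by
  have hne : x ≠ y := fun h => absurd (h ▸ hxy) (lt_irrefl _)
  have hgt : max (g y) t < max (g x) t := by
    by_contra! hle
    exact hne (hy.2 x hx.1 (max_le_max_right _ hxy.le) hle)
  have htx : t < g x := by grind
  have hgyx : g y < g x := by grind
  have hsy : s < f y := by
    by_contra! hle
    exact hne (hx.2 y hy.1 (by grind) hgt.le).symm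
  obtain ⟨p, hp, hsp, hpy, hpsucc, hpmax⟩ := exists_pred_mem_image hs hsy
  obtain ⟨q, hq, htq, hqx, hqsucc, hqmax⟩ := exists_pred_mem_image ht htx
  have hxp := hpmax _ (Finset.mem_image_of_mem f (hB hx.1)) hxy
  have hyq := hqmax _ (Finset.mem_image_of_mem g (hB hy.1)) hgyx
  have hempty : ∀ w ∈ B, f w ≤ p → ¬ g w ≤ q := by
    intro w hw h1 h2
    obtain ⟨z, hz, hz1, hz2⟩ := exists_stairMinimal_le hB hf hg hemp hw
    have hzp : f z ≤ p := (le_max_left _ _).trans (hz1.trans (max_le h1 hsp))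
    have hzq : g z ≤ q := (le_max_left _ _).trans (hz2.trans (max_le h2 htq))
    refine hbetween z hz (not_le.mp fun hle => ?_) (hzp.trans_lt hpy)
    have := hx.2 z hz.1 (max_le_max_right _ hle) (max_le_max_right _ (hzq.trans hqx.le))
    exact absurd (this ▸ hzq) (not_le.mpr hqx)
  exact ⟨p, q, ⟨hp, hq, hsp, htq, hempty, hx.1, Or.inr ⟨hqx, hqsucc, hxp⟩⟩,
    ⟨hp, hq, hsp, htq, hempty, hy.1, Or.inl ⟨hpy, hpsucc, hyq⟩⟩⟩

end Staircase

/-- Given the unique circumsphere of `σ`, a conflict pair is a conflict on the staircase of the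
points inside that sphere. -/
lemma conflictAt_iff_stairConflict {d : ℕ} {X σ : Finset (Pt d)} {γ : Pt d → ℝ × ℝ}
    {c : Pt d} {r : ℝ} (hσX : σ ⊆ X) (hcard : σ.card = d + 1) (hne : σ.Nonempty) (hr : 0 ≤ r)
    (hon : OnSphere c r σ) (huniq : ∀ c' r', OnSphere c' r' σ → c' = c ∧ r' = r)
    (p : ℝ × ℝ) (x : Pt d) :
    ConflictAt X γ p σ x ↔
      StairConflict X (X.filter fun w => ‖w - c‖ < r) (fun w => (γ w).1) (fun w => (γ w).2)
        (gammaJoin γ σ hne).1 (gammaJoin γ σ hne).2 p.1 p.2 x := by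
  have hsub : (gammaJoin γ σ hne).1 ≤ p.1 ∧ (gammaJoin γ σ hne).2 ≤ p.2 ↔
      σ ⊆ Xsub X γ p := by
    simp only [gammaJoin, Finset.sup'_le_iff, Xsub, Finset.subset_iff, Finset.mem_filter,
      Prod.le_def]
    exact ⟨fun h w hw => ⟨hσX hw, h.1 w hw, h.2 w hw⟩,
      fun h => ⟨fun w hw => (h hw).2.1, fun w hw => (h hw).2.2⟩⟩
  constructor
  · rintro ⟨h1, h2, ⟨-, hσ, c', r', -, hon', hemp⟩, -, ⟨c'', r'', -, hon'', hin⟩, hstep⟩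
    obtain ⟨rfl, rfl⟩ := huniq _ _ hon'
    obtain ⟨rfl, rfl⟩ := huniq _ _ hon''
    have hxp : x ∈ X → (γ x).1 ≤ p.1 → ¬ (γ x).2 ≤ p.2 := fun hX h h' =>
      hemp x (Finset.mem_filter.mpr ⟨hX, h, h'⟩) hin
    obtain ⟨hs, ht⟩ := hsub.mpr hσ
    have hempty : ∀ w ∈ X.filter fun w => ‖w - c''‖ < r'',
        (γ w).1 ≤ p.1 → ¬ (γ w).2 ≤ p.2 := fun w hw h h' =>
      hemp w (Finset.mem_filter.mpr ⟨(Finset.mem_filter.mp hw).1, h, h'⟩)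
        (Finset.mem_filter.mp hw).2
    rcases hstep with ⟨a, -, hpa, hmin, hxa⟩ | ⟨a, -, hpa, hmin, hxa⟩ <;>
      obtain ⟨hX, hx1, hx2⟩ := Finset.mem_filter.mp hxa <;>
      refine ⟨h1, h2, hs, ht, hempty, Finset.mem_filter.mpr ⟨hX, hin⟩, ?_⟩
    · exact Or.inl ⟨not_le.mp fun h => hxp hX h hx2,
        fun b hb hlt => hx1.trans (hmin _ (Finset.mem_image_of_mem _ hb) hlt), hx2⟩
    · exact Or.inr ⟨not_le.mp (hxp hX hx1),
        fun b hb hlt => hx2.trans (hmin _ (Finset.mem_image_of_mem _ hb) hlt), hx1⟩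
  · rintro ⟨h1, h2, hs, ht, hempty, hxB, hstep⟩
    obtain ⟨hX, hin⟩ := Finset.mem_filter.mp hxB
    refine ⟨h1, h2, ⟨hne, hsub.mp ⟨hs, ht⟩, c, r, hr, hon, fun w hw hlt => ?_⟩, hcard,
      ⟨c, r, hr, hon, hin⟩, ?_⟩
    · obtain ⟨hwX, hw1, hw2⟩ := Finset.mem_filter.mp hw
      exact hempty w (Finset.mem_filter.mpr ⟨hwX, hlt⟩) hw1 hw2
    · refine hstep.imp (fun ⟨hlt, hmin, hle⟩ => ?_) (fun ⟨hlt, hmin, hle⟩ => ?_)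
      · refine ⟨(γ x).1, Finset.mem_image_of_mem _ hX, hlt, fun b hb => ?_,
          Finset.mem_filter.mpr ⟨hX, le_rfl, hle⟩⟩
        obtain ⟨w, hw, rfl⟩ := Finset.mem_image.mp hb
        exact hmin w hw
      · refine ⟨(γ x).2, Finset.mem_image_of_mem _ hX, hlt, fun b hb => ?_,
          Finset.mem_filter.mpr ⟨hX, hle, le_rfl⟩⟩
        obtain ⟨w, hw, rfl⟩ := Finset.mem_image.mp hb
        exact hmin w hw

/-- For `x, y ∈ T_σ` with `γ₁(x) < γ₁(y)`, `(σ,x,y)` is a conflict triple at some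
`p` iff there is no `z ∈ T_σ` with `γ₁(x) < γ₁(z) < γ₁(y)`. -/
theorem conflictTripleIffConsecutive
    {d : ℕ} (hd : 1 ≤ d) (X : Finset (Pt d)) (γ : Pt d → ℝ × ℝ)
    (hgen : GenPos X)
    (hinj1 : Set.InjOn (fun z => (γ z).1) (↑X : Set (Pt d)))
    (hinj2 : Set.InjOn (fun z => (γ z).2) (↑X : Set (Pt d)))
    (σ : Finset (Pt d)) (x y : Pt d)
    (hx : ConflictPair X γ σ x) (hy : ConflictPair X γ σ y)
    (hlt : (γ x).1 < (γ y).1) :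
    (∃ p : ℝ × ℝ, ConflictAt X γ p σ x ∧ ConflictAt X γ p σ y) ↔
      ¬ ∃ z : Pt d, ConflictPair X γ σ z ∧ (γ x).1 < (γ z).1 ∧ (γ z).1 < (γ y).1 := by
  obtain ⟨_, _, _, ⟨hne, hσ, c, r, hr, hon, _⟩, hcard, _⟩ := id hx
  have hσX : σ ⊆ X := hσ.trans (Finset.filter_subset _ _)
  have hind := (hgen σ hσX hne hcard.le).1
  have hiff := conflictAt_iff_stairConflict (γ := γ) hσX hcard hne hr hon
    fun c' r' h' => OnSphere.eq_of_affineIndependent hind hcard h' hon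
  have hB : (X.filter fun w => ‖w - c‖ < r) ⊆ X := Finset.filter_subset _ _
  have hs : (gammaJoin γ σ hne).1 ∈ X.image fun w => (γ w).1 := by
    obtain ⟨w, hw, e⟩ := σ.exists_mem_eq_sup' hne fun w => (γ w).1
    exact Finset.mem_image.mpr ⟨w, hσX hw, e.symm⟩
  have ht : (gammaJoin γ σ hne).2 ∈ X.image fun w => (γ w).2 := by
    obtain ⟨w, hw, e⟩ := σ.exists_mem_eq_sup' hne fun w => (γ w).2
    exact Finset.mem_image.mpr ⟨w, hσX hw, e.symm⟩
  have hemp : ∀ w ∈ X.filter fun w => ‖w - c‖ < r,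
      (γ w).1 ≤ (gammaJoin γ σ hne).1 → ¬ (γ w).2 ≤ (gammaJoin γ σ hne).2 := by
    obtain ⟨p, hp⟩ := hx
    obtain ⟨-, -, hsp, htp, hempty, -⟩ := (hiff p x).mp hp
    exact fun w hw h h' => hempty w hw (h.trans hsp) (h'.trans htp)
  have hpair : ∀ z, ConflictPair X γ σ z ↔
      StairMinimal (X.filter fun w => ‖w - c‖ < r) (fun w => (γ w).1) (fun w => (γ w).2)
        (gammaJoin γ σ hne).1 (gammaJoin γ σ hne).2 z := by
    refine fun z => ⟨fun ⟨p, hp⟩ => ((hiff p z).mp hp).stairMinimal hB hinj1 hinj2, fun h => ?_⟩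
    obtain ⟨p, q, hpq⟩ := h.exists_stairConflict hB hs ht hemp
    exact ⟨(p, q), (hiff (p, q) z).mpr hpq⟩
  constructor
  · rintro ⟨p, hpx, hpy⟩ ⟨z, hz, hxz, hzy⟩
    exact ((hiff p x).mp hpx).not_between hB hinj2 ((hiff p y).mp hpy) hlt ((hpair z).mp hz)
      hxz hzy
  · intro hno
    obtain ⟨p, q, hpx, hpy⟩ := ((hpair x).mp hx).exists_common_stairConflict hB hinj1 hinj2 hs ht
      hemp ((hpair y).mp hy) hlt
      fun z hz hxz hzy => hno ⟨z, (hpair z).mpr hz, hxz, hzy⟩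
    exact ⟨(p, q), (hiff (p, q) x).mpr hpx, (hiff (p, q) y).mpr hpy⟩
end
end

section
/- Let Z ⊆ ℝ^d be finite and in general position, let η ∈ DelT(Z), and let z ∈ Z∖η. If there exists a (Z∖{z})-empty circumsphere S⁺ of η such that z lies inside or on S⁺, then η ∪ {z} ∈ DelT(Z). -/
noncomputable section

attribute [local instance] Classical.propDecidable

variable {d : ℕ}

/-- The squared distance to a point of the line through `a` and `b`. -/
theorem norm_sub_affineCombination_sq (a b w : Pt d) (t : ℝ) :
    ‖w - ((1 - t) • a + t • b)‖ ^ 2 =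
      (1 - t) * ‖w - a‖ ^ 2 + t * ‖w - b‖ ^ 2 - t * (1 - t) * ‖a - b‖ ^ 2 := by
  have hw : w - ((1 - t) • a + t • b) = (1 - t) • (w - a) + t • (w - b) := by module
  have hab : a - b = (w - b) - (w - a) := by abel
  rw [hw, hab, norm_add_sq_real, norm_sub_sq_real (w - b) (w - a), norm_smul, norm_smul,
    mul_pow, mul_pow,
    Real.norm_eq_abs, Real.norm_eq_abs, sq_abs, sq_abs, real_inner_smul_left,
    real_inner_smul_right, real_inner_comm (w - a) (w - b)]
  ring

/-- The segment from a nonnegative to a nonpositive number passes through zero. -/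
theorem exists_convexCombination_eq_zero {a b : ℝ} (ha : 0 ≤ a) (hb : b ≤ 0) :
    ∃ t : ℝ, 0 ≤ t ∧ t ≤ 1 ∧ (1 - t) * a + t * b = 0 := by
  rcases ha.eq_or_lt with rfl | ha
  · exact ⟨0, by simp⟩
  · have hab : 0 < a - b := by linarith
    refine ⟨a / (a - b), by positivity, (div_le_one hab).2 (by linarith), ?_⟩
    field_simp
    ring

/-- If `η ∈ DelT(Z)`, `z ∈ Z \ η`, and there is a `(Z∖{z})`-empty circumsphere of
`η` with `z` inside or on it, then `η ∪ {z} ∈ DelT(Z)`. -/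
theorem delaunayInsertOfEmptySphere
    {d : ℕ} (hd : 1 ≤ d) (Z : Finset (Pt d)) (hgen : GenPos Z)
    (η : Finset (Pt d)) (hη : η ∈ DelT Z) (z : Pt d) (hz : z ∈ Z) (hzη : z ∉ η)
    (h : ∃ c : Pt d, ∃ r : ℝ, 0 ≤ r ∧ OnSphere c r η ∧ SphEmpty c r (Z.erase z) ∧
      ‖z - c‖ ≤ r) :
    insert z η ∈ DelT Z := by
  obtain ⟨hne, hsub, c₀, r₀, hr₀, hon₀, hemp₀⟩ := hη
  obtain ⟨c₁, r₁, hr₁, hon₁, hemp₁, hz₁⟩ := h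
  have hz₀ : r₀ ≤ ‖z - c₀‖ := not_lt.1 (hemp₀ z hz)
  obtain ⟨t, ht₀, ht₁, ht⟩ := exists_convexCombination_eq_zero
    (a := ‖z - c₀‖ ^ 2 - r₀ ^ 2) (b := ‖z - c₁‖ ^ 2 - r₁ ^ 2)
    (sub_nonneg.2 (by gcongr)) (sub_nonpos.2 (by gcongr))
  have key (w : Pt d) : ‖w - ((1 - t) • c₀ + t • c₁)‖ ^ 2 =
      ‖z - ((1 - t) • c₀ + t • c₁)‖ ^ 2 +
        ((1 - t) * (‖w - c₀‖ ^ 2 - r₀ ^ 2) + t * (‖w - c₁‖ ^ 2 - r₁ ^ 2)) := by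
    rw [norm_sub_affineCombination_sq, norm_sub_affineCombination_sq]
    linarith
  refine ⟨Finset.insert_nonempty _ _, Finset.insert_subset hz hsub,
    (1 - t) • c₀ + t • c₁, ‖z - ((1 - t) • c₀ + t • c₁)‖, norm_nonneg _, ?_, ?_⟩
  · intro w hw
    rcases Finset.mem_insert.1 hw with rfl | hw
    · rfl
    · rw [← sq_eq_sq₀ (norm_nonneg _) (norm_nonneg _), key w, hon₀ w hw, hon₁ w hw]
      ring
  · intro w hw
    by_cases hwz : w = z
    · simp [hwz]
    · have h₀ : r₀ ≤ ‖w - c₀‖ := not_lt.1 (hemp₀ w hw)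
      have h₁ : r₁ ≤ ‖w - c₁‖ := not_lt.1 (hemp₁ w (Finset.mem_erase.2 ⟨hwz, hw⟩))
      have h₀' : 0 ≤ (1 - t) * (‖w - c₀‖ ^ 2 - r₀ ^ 2) :=
        mul_nonneg (sub_nonneg.2 ht₁) (sub_nonneg.2 (by gcongr))
      have h₁' : 0 ≤ t * (‖w - c₁‖ ^ 2 - r₁ ^ 2) :=
        mul_nonneg ht₀ (sub_nonneg.2 (by gcongr))
      rw [not_lt, ← sq_le_sq₀ (norm_nonneg _) (norm_nonneg _), key w]
      linarith
end
end

section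
/- Suppose X has the Δ-property. If τ is a nonempty subset of X with τ ∈ DelT(X_{γ(τ)}) and τ is not contained in Δ, then τ is a face of a conflict simplex: there exists a conflict pair (σ,x) with τ ⊆ σ ∪ {x}. -/
noncomputable section

attribute [local instance] Classical.propDecidable

variable {d : ℕ}

/-- The affine function `z ↦ 2⟪v, z⟫ + b` determines `v` and `b` by its values on an affinely
spanning set. -/
lemma affine_coeffs_eq_zero_of_affineSpan_eq_top {S : Set (Pt d)} (hS : affineSpan ℝ S = ⊤)
    {v : Pt d} {b : ℝ} (h : ∀ z ∈ S, 2 * inner ℝ v z + b = 0) : v = 0 ∧ b = 0 := by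
  have hne : S.Nonempty := by
    rw [← affineSpan_nonempty ℝ, hS]; exact ⟨0, trivial⟩
  have hv : v = 0 := by
    have hle : vectorSpan ℝ S ≤ (ℝ ∙ v)ᗮ := by
      rw [vectorSpan_def, Submodule.span_le]
      rintro _ ⟨p, hp, q, hq, rfl⟩
      have h1 := h p hp
      have h2 := h q hq
      simp only [vsub_eq_sub, SetLike.mem_coe, Submodule.mem_orthogonal_singleton_iff_inner_right,
        inner_sub_right]
      linarith
    rw [← direction_affineSpan, hS, AffineSubspace.direction_top] at hle
    have : v ∈ (ℝ ∙ v)ᗮ := hle trivial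
    rw [Submodule.mem_orthogonal_singleton_iff_inner_right] at this
    exact inner_self_eq_zero.mp this
  obtain ⟨z, hz⟩ := hne
  have := h z hz
  rw [hv] at this
  exact ⟨hv, by simpa using this⟩

/-- A set that does not span affinely lies in the zero set of a nontrivial affine function. -/
lemma exists_affine_coeffs_of_affineSpan_ne_top {S : Set (Pt d)} (hS : affineSpan ℝ S ≠ ⊤) :
    ∃ (v : Pt d) (b : ℝ), (v ≠ 0 ∨ b ≠ 0) ∧ ∀ z ∈ S, 2 * inner ℝ v z + b = 0 := by
  rcases S.eq_empty_or_nonempty with rfl | ⟨z₀, hz₀⟩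
  · exact ⟨0, 1, by simp, by simp⟩
  have hdir : vectorSpan ℝ S ≠ ⊤ := by
    rw [← direction_affineSpan]
    intro h
    exact hS ((AffineSubspace.direction_eq_top_iff_of_nonempty
      ⟨z₀, subset_affineSpan ℝ S hz₀⟩).mp h)
  rw [Ne, ← Submodule.orthogonal_eq_bot_iff] at hdir
  obtain ⟨v, hv, hv0⟩ := Submodule.exists_mem_ne_zero_of_ne_bot hdir
  refine ⟨v, -(2 * inner ℝ v z₀), Or.inl hv0, fun z hz => ?_⟩
  have := (Submodule.mem_orthogonal' _ _).mp hv (z -ᵥ z₀) (vsub_mem_vectorSpan ℝ hz hz₀)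
  rw [vsub_eq_sub, inner_sub_right] at this
  linarith

lemma affine_nonpos_of_mem_convexHull {S : Set (Pt d)} {x v : Pt d} {b : ℝ}
    (hx : x ∈ convexHull ℝ S) (h : ∀ z ∈ S, 2 * inner ℝ v z + b ≤ 0) :
    2 * inner ℝ v x + b ≤ 0 := by
  have hconv : Convex ℝ {z : Pt d | inner ℝ v z ≤ -b / 2} :=
    convex_halfSpace_le (innerSL ℝ v).isLinear _
  have : x ∈ {z : Pt d | inner ℝ v z ≤ -b / 2} := by
    refine convexHull_min (fun z hz => ?_) hconv hx
    have := h z hz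
    simp only [Set.mem_ofPred_eq]
    linarith
  simp only [Set.mem_ofPred_eq] at this
  linarith

/-- The power of `z` with respect to the sphere with center `c` and squared radius `‖c‖² + k`. -/
def spherePower (c : Pt d) (k : ℝ) (z : Pt d) : ℝ := ‖z‖ ^ 2 - 2 * inner ℝ c z - k

lemma spherePower_eq (c : Pt d) (r : ℝ) (z : Pt d) :
    spherePower c (r ^ 2 - ‖c‖ ^ 2) z = ‖z - c‖ ^ 2 - r ^ 2 := by
  rw [spherePower, norm_sub_sq_real, real_inner_comm]
  ring

lemma spherePower_add_smul (c v : Pt d) (k b t : ℝ) (z : Pt d) :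
    spherePower (c + t • v) (k + t * b) z =
      spherePower c k z - t * (2 * inner ℝ v z + b) := by
  simp only [spherePower, inner_add_left, real_inner_smul_left]
  ring

/-- If the points of `P` on a `P`-empty sphere do not span, then the sphere can be moved, keeping
these points on it and not increasing the power of a given point `x` of the convex hull of `P`,
until it passes through a further point of `P`. -/
lemma exists_spherePower_tight_ssubset {P : Finset (Pt d)} (hP : affineSpan ℝ (P : Set (Pt d)) = ⊤)
    {x : Pt d} (hx : x ∈ convexHull ℝ (P : Set (Pt d))) {c : Pt d} {k : ℝ}
    (hnonneg : ∀ z ∈ P, 0 ≤ spherePower c k z)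
    (hspan : affineSpan ℝ {z | z ∈ P ∧ spherePower c k z = 0} ≠ ⊤) :
    ∃ (c' : Pt d) (k' : ℝ), (∀ z ∈ P, 0 ≤ spherePower c' k' z) ∧
      spherePower c' k' x ≤ spherePower c k x ∧
      P.filter (fun z => spherePower c k z = 0) ⊂ P.filter (fun z => spherePower c' k' z = 0) := by
  obtain ⟨v, b, hg, hgx, hpos⟩ : ∃ (v : Pt d) (b : ℝ),
      (∀ z ∈ P, spherePower c k z = 0 → 2 * inner ℝ v z + b = 0) ∧
      0 ≤ 2 * inner ℝ v x + b ∧ ∃ z ∈ P, 0 < 2 * inner ℝ v z + b := by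
    obtain ⟨v, b, hne, hg⟩ := exists_affine_coeffs_of_affineSpan_ne_top hspan
    have hg' : ∀ z ∈ P, spherePower c k z = 0 → 2 * inner ℝ v z + b = 0 :=
      fun z hz hz0 => hg z ⟨hz, hz0⟩
    have hneg (z : Pt d) : 2 * inner ℝ (-v) z + -b = -(2 * inner ℝ v z + b) := by
      rw [inner_neg_left]; ring
    have hnegg : ∀ z ∈ P, spherePower c k z = 0 → 2 * inner ℝ (-v) z + -b = 0 := by
      intro z hz hz0
      rw [hneg, hg' z hz hz0, neg_zero]
    rcases lt_trichotomy (2 * inner ℝ v x + b) 0 with h | h | h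
    · refine ⟨-v, -b, hnegg, by rw [hneg]; linarith, ?_⟩
      by_contra! hcon
      have := affine_nonpos_of_mem_convexHull hx hcon
      rw [hneg] at this
      linarith
    · by_cases hex : ∃ z ∈ P, 0 < 2 * inner ℝ v z + b
      · exact ⟨v, b, hg', h.ge, hex⟩
      refine ⟨-v, -b, hnegg, by rw [hneg, h, neg_zero], ?_⟩
      by_contra! hcon
      push Not at hex
      have := affine_coeffs_eq_zero_of_affineSpan_eq_top hP (v := v) (b := b) fun z hz =>
        le_antisymm (hex z hz) (by have := hcon z hz; rw [hneg] at this; linarith)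
      tauto
    · refine ⟨v, b, hg', h.le, ?_⟩
      by_contra! hcon
      exact absurd (affine_nonpos_of_mem_convexHull hx hcon) (not_le.mpr h)
  obtain ⟨w, hw, hmin⟩ := (P.filter fun z => 0 < 2 * inner ℝ v z + b).exists_min_image
    (fun z => spherePower c k z / (2 * inner ℝ v z + b))
    (by obtain ⟨z, hz⟩ := hpos; exact ⟨z, by simpa using hz⟩)
  obtain ⟨hwP, hwpos⟩ := Finset.mem_filter.mp hw
  set t := spherePower c k w / (2 * inner ℝ v w + b) with ht
  have ht0 : 0 ≤ t := div_nonneg (hnonneg w hwP) hwpos.le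
  refine ⟨c + t • v, k + t * b, fun z hz => ?_, ?_, ?_⟩
  · rw [spherePower_add_smul]
    rcases le_or_gt (2 * inner ℝ v z + b) 0 with h | h
    · have := mul_nonpos_of_nonneg_of_nonpos ht0 h
      have := hnonneg z hz
      linarith
    · have := hmin z (Finset.mem_filter.mpr ⟨hz, h⟩)
      rw [le_div_iff₀ h] at this
      linarith
  · rw [spherePower_add_smul]
    have := mul_nonneg ht0 hgx
    linarith
  · rw [Finset.ssubset_iff_of_subset]
    · refine ⟨w, Finset.mem_filter.mpr ⟨hwP, ?_⟩, fun hw' => ?_⟩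
      · rw [spherePower_add_smul, ht, div_mul_cancel₀ _ hwpos.ne', sub_self]
      · exact hwpos.ne' (hg w hwP (Finset.mem_filter.mp hw').2)
    · intro z hz
      obtain ⟨hzP, hz0⟩ := Finset.mem_filter.mp hz
      refine Finset.mem_filter.mpr ⟨hzP, ?_⟩
      rw [spherePower_add_smul, hz0, hg z hzP hz0, mul_zero, sub_zero]

/-- A `P`-empty sphere can be moved, keeping the points of `P` on it and not increasing the power
of a given point `x` of the convex hull of `P`, until the points of `P` on it span. -/
lemma exists_spherePower_tight_affineSpan_eq_top {P : Finset (Pt d)}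
    (hP : affineSpan ℝ (P : Set (Pt d)) = ⊤) {x : Pt d} (hx : x ∈ convexHull ℝ (P : Set (Pt d)))
    (c : Pt d) (k : ℝ) (hnonneg : ∀ z ∈ P, 0 ≤ spherePower c k z) :
    ∃ (c' : Pt d) (k' : ℝ), (∀ z ∈ P, 0 ≤ spherePower c' k' z) ∧
      spherePower c' k' x ≤ spherePower c k x ∧
      (∀ z ∈ P, spherePower c k z = 0 → spherePower c' k' z = 0) ∧
      affineSpan ℝ {z | z ∈ P ∧ spherePower c' k' z = 0} = ⊤ := by
  by_cases hspan : affineSpan ℝ {z | z ∈ P ∧ spherePower c k z = 0} = ⊤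
  · exact ⟨c, k, hnonneg, le_rfl, fun _ _ h => h, hspan⟩
  obtain ⟨c₁, k₁, hnonneg₁, hle₁, hss⟩ := exists_spherePower_tight_ssubset hP hx hnonneg hspan
  have hdec : P.card - (P.filter fun z => spherePower c₁ k₁ z = 0).card <
      P.card - (P.filter fun z => spherePower c k z = 0).card := by
    have := Finset.card_lt_card hss
    have := Finset.card_filter_le P (fun z => spherePower c₁ k₁ z = 0)
    omega
  obtain ⟨c₂, k₂, hnonneg₂, hle₂, htight, hspan₂⟩ :=
    exists_spherePower_tight_affineSpan_eq_top hP hx c₁ k₁ hnonneg₁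
  refine ⟨c₂, k₂, hnonneg₂, hle₂.trans hle₁, fun z hz hz0 => ?_, hspan₂⟩
  exact htight z hz (Finset.mem_filter.mp (hss.1 (Finset.mem_filter.mpr ⟨hz, hz0⟩))).2
termination_by P.card - (P.filter fun z => spherePower c k z = 0).card

/-- In general position, no further point lies on a circumsphere of an affinely spanning set of
`d + 1` points. -/
lemma GenPos.norm_sub_ne {X : Finset (Pt d)} (hgen : GenPos X) {Q : Finset (Pt d)} (hQX : Q ⊆ X)
    (hcard : Q.card = d + 1) (hspan : affineSpan ℝ (Q : Set (Pt d)) = ⊤) {c : Pt d} {r : ℝ}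
    (hr : 0 ≤ r) (hon : OnSphere c r Q) {z : Pt d} (hzX : z ∈ X) (hzQ : z ∉ Q) :
    ‖z - c‖ ≠ r := by
  have hne : Q.Nonempty := Finset.card_pos.mp (by omega)
  refine (hgen Q hQX hne hcard.le).2 c r hr hon (fun c' r' hr' hon' => ?_) z hzX hzQ
  have h := affine_coeffs_eq_zero_of_affineSpan_eq_top hspan (v := c' - c)
    (b := (r' ^ 2 - ‖c'‖ ^ 2) - (r ^ 2 - ‖c‖ ^ 2)) fun w hw => by
      have h1 := spherePower_eq c r w
      have h2 := spherePower_eq c' r' w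
      rw [hon w hw, sub_self, spherePower] at h1
      rw [hon' w hw, sub_self, spherePower] at h2
      rw [inner_sub_left]
      linarith
  obtain ⟨w, hw⟩ := hne
  rw [← hon w hw, ← hon' w hw, sub_eq_zero.mp h.1]

lemma GenPos.affineSpan_eq_top {X : Finset (Pt d)} (hgen : GenPos X) {Q : Finset (Pt d)}
    (hQX : Q ⊆ X) (hcard : Q.card = d + 1) : affineSpan ℝ (Q : Set (Pt d)) = ⊤ := by
  have hind := (hgen Q hQX (Finset.card_pos.mp (by omega)) hcard.le).1
  have := hind.affineSpan_eq_top_iff_card_eq_finrank_add_one.mpr (by simp [hcard])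
  simpa using this

/-- If the convex hull of `P` contains `x ∉ P`, then a simplex `τ` with a `P`-empty circumsphere
that encloses `x` is a face of a Delaunay `d`-simplex of `P` in conflict with `x`. -/
lemma GenPos.exists_conflict_simplex {X : Finset (Pt d)} (hgen : GenPos X) {P : Finset (Pt d)}
    (hPX : P ⊆ X) (hspan : affineSpan ℝ (P : Set (Pt d)) = ⊤) {x : Pt d} (hxX : x ∈ X)
    (hxP : x ∉ P) (hx : x ∈ convexHull ℝ (P : Set (Pt d))) {τ : Finset (Pt d)} (hτP : τ ⊆ P)
    {c : Pt d} {r : ℝ} (hr : 0 ≤ r) (hon : OnSphere c r τ) (hempty : SphEmpty c r P)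
    (hxc : ‖x - c‖ ≤ r) :
    ∃ σ : Finset (Pt d), σ ⊆ P ∧ τ ⊆ σ ∧ σ.card = d + 1 ∧
      ∃ c r, 0 ≤ r ∧ OnSphere c r σ ∧ SphEmpty c r P ∧ ‖x - c‖ < r := by
  obtain ⟨c', k', hnonneg, hle, htight, htop⟩ :=
    exists_spherePower_tight_affineSpan_eq_top hspan hx c (r ^ 2 - ‖c‖ ^ 2) fun z hz => by
      rw [spherePower_eq, sub_nonneg]
      exact pow_le_pow_left₀ hr (not_lt.mp (hempty z hz)) 2
  have hpow (z : Pt d) : spherePower c' k' z = ‖z - c'‖ ^ 2 - (k' + ‖c'‖ ^ 2) := by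
    rw [spherePower, norm_sub_sq_real, real_inner_comm]
    ring
  have hx' : ‖x - c'‖ ^ 2 ≤ k' + ‖c'‖ ^ 2 := by
    rw [hpow, spherePower_eq] at hle
    have := pow_le_pow_left₀ (norm_nonneg _) hxc 2
    linarith
  obtain ⟨r', hr', hrk⟩ : ∃ r' : ℝ, 0 ≤ r' ∧ r' ^ 2 = k' + ‖c'‖ ^ 2 :=
    ⟨√(k' + ‖c'‖ ^ 2), Real.sqrt_nonneg _, Real.sq_sqrt ((sq_nonneg _).trans hx')⟩
  rw [← hrk] at hx'
  have htight' (z : Pt d) : spherePower c' k' z = 0 ↔ ‖z - c'‖ = r' := by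
    rw [hpow, ← hrk, sub_eq_zero, pow_left_inj₀ (norm_nonneg _) hr' two_ne_zero]
  obtain ⟨s, hsub, hs, hind⟩ := exists_affineIndependent ℝ (Pt d)
    {z | z ∈ P ∧ spherePower c' k' z = 0}
  rw [htop] at hs
  have hfin : s.Finite := P.finite_toSet.subset fun z hz => (hsub hz).1
  lift s to Finset (Pt d) using hfin
  have hcard : s.card = d + 1 := by
    have hs' : affineSpan ℝ (Set.range fun q : ↥(s : Set (Pt d)) => (q : Pt d)) = ⊤ := by simpa using hs
    simpa using hind.affineSpan_eq_top_iff_card_eq_finrank_add_one.mp hs'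
  have hsP : s ⊆ P := fun z hz => (hsub hz).1
  have hson : OnSphere c' r' s := fun z hz => (htight' z).mp (hsub hz).2
  refine ⟨s, hsP, fun z hz => ?_, hcard, c', r', hr', hson, fun z hz => ?_, ?_⟩
  · by_contra hzs
    refine hgen.norm_sub_ne (hsP.trans hPX) hcard hs hr' hson (hPX (hτP hz)) hzs ?_
    rw [← htight']
    exact htight z (hτP hz) (by rw [spherePower_eq, hon z hz, sub_self])
  · have := hnonneg z hz
    rw [hpow, ← hrk, sub_nonneg] at this
    exact not_lt.mpr ((pow_le_pow_iff_left₀ hr' (norm_nonneg _) two_ne_zero).mp this)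
  · exact lt_of_le_of_ne ((pow_le_pow_iff_left₀ (norm_nonneg _) hr' two_ne_zero).mp hx') <|
      hgen.norm_sub_ne (hsP.trans hPX) hcard hs hr' hson hxX fun h => hxP (hsP h)

/-- If `X` has the Δ-property, `τ ∈ DelT(X_{γ(τ)})` is nonempty, and `τ ⊄ Δ`,
then `τ` is a face of a conflict simplex. -/
theorem faceOfConflictSimplexOfDelaunay
    {d : ℕ} (hd : 1 ≤ d) (X : Finset (Pt d)) (γ : Pt d → ℝ × ℝ)
    (hgen : GenPos X)
    (hinj1 : Set.InjOn (fun z => (γ z).1) (↑X : Set (Pt d)))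
    (hinj2 : Set.InjOn (fun z => (γ z).2) (↑X : Set (Pt d)))
    (Δ : Finset (Pt d)) (hΔ : IsDelta X γ Δ)
    (τ : Finset (Pt d)) (hτne : τ.Nonempty) (hτX : τ ⊆ X)
    (hτDel : τ ∈ DelT (Xsub X γ (gammaJoin γ τ hτne)))
    (hτΔ : ¬ τ ⊆ Δ) :
    ∃ σ : Finset (Pt d), ∃ x : Pt d, ConflictPair X γ σ x ∧ τ ⊆ insert x σ := by
  obtain ⟨hΔX, hΔcard, hΔfirst, -, hΔhull⟩ := hΔ
  obtain ⟨-, -, c, r, hr, hon, hempty⟩ := hτDel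
  obtain ⟨u, huτ, huΔ⟩ := Finset.not_subset.mp hτΔ
  obtain ⟨x, hxτ, hqx⟩ := τ.exists_mem_eq_sup' hτne fun z => (γ z).1
  obtain ⟨y, hyτ, hqy⟩ := τ.exists_mem_eq_sup' hτne fun z => (γ z).2
  have hq : gammaJoin γ τ hτne = ((γ x).1, (γ y).2) := Prod.ext hqx hqy
  rw [hq] at hempty
  have hmax1 : ∀ z ∈ τ, (γ z).1 ≤ (γ x).1 := fun z hz =>
    (Finset.le_sup' (fun z => (γ z).1) hz).trans_eq hqx
  have hmax2 : ∀ z ∈ τ, (γ z).2 ≤ (γ y).2 := fun z hz =>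
    (Finset.le_sup' (fun z => (γ z).2) hz).trans_eq hqy
  have hΔlt : ∀ z ∈ Δ, (γ z).1 < (γ x).1 ∧ (γ z).2 < (γ y).2 := fun z hz =>
    ⟨(hΔfirst z hz u (hτX huτ) huΔ).1.trans_le (hmax1 u huτ),
      (hΔfirst z hz u (hτX huτ) huΔ).2.trans_le (hmax2 u huτ)⟩
  obtain ⟨w, hw, hwmax⟩ := (X.filter fun z => (γ z).1 < (γ x).1).exists_max_image
    (fun z => (γ z).1) (by
      obtain ⟨z, hz⟩ : Δ.Nonempty := Finset.card_pos.mp (by omega)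
      exact ⟨z, Finset.mem_filter.mpr ⟨hΔX hz, (hΔlt z hz).1⟩⟩)
  obtain ⟨hwX, hwx⟩ := Finset.mem_filter.mp hw
  have hpred : ∀ z ∈ X, (γ z).1 < (γ x).1 → (γ z).1 ≤ (γ w).1 := fun z hz hzx =>
    hwmax z (Finset.mem_filter.mpr ⟨hz, hzx⟩)
  have hmem : ∀ z ∈ X, (γ z).1 < (γ x).1 → (γ z).2 ≤ (γ y).2 →
      z ∈ Xsub X γ ((γ w).1, (γ y).2) := fun z hz h1 h2 =>
    Finset.mem_filter.mpr ⟨hz, hpred z hz h1, h2⟩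
  have hxX := hτX hxτ
  have hPX : Xsub X γ ((γ w).1, (γ y).2) ⊆ X := Finset.filter_subset _ _
  have hΔP : Δ ⊆ Xsub X γ ((γ w).1, (γ y).2) := fun z hz =>
    hmem z (hΔX hz) (hΔlt z hz).1 (hΔlt z hz).2.le
  have hPq : Xsub X γ ((γ w).1, (γ y).2) ⊆ Xsub X γ ((γ x).1, (γ y).2) := fun z hz => by
    obtain ⟨hzX, hz1, hz2⟩ := Finset.mem_filter.mp hz
    exact Finset.mem_filter.mpr ⟨hzX, hz1.trans hwx.le, hz2⟩
  have hτP : τ.erase x ⊆ Xsub X γ ((γ w).1, (γ y).2) := fun z hz => by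
    obtain ⟨hzx, hzτ⟩ := Finset.mem_erase.mp hz
    exact hmem z (hτX hzτ) (lt_of_le_of_ne (hmax1 z hzτ) fun h => hzx (hinj1 (hτX hzτ) hxX h))
      (hmax2 z hzτ)
  have hspan : affineSpan ℝ (↑(Xsub X γ ((γ w).1, (γ y).2)) : Set (Pt d)) = ⊤ :=
    top_le_iff.mp <| (hgen.affineSpan_eq_top hΔX hΔcard).symm.trans_le
      (affineSpan_mono ℝ (Finset.coe_subset.mpr hΔP))
  obtain ⟨σ, hσP, hτσ, hσcard, c', r', hr', hσon, hσempty, hxσ⟩ :=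
    hgen.exists_conflict_simplex hPX hspan hxX
      (fun h => hwx.not_ge (Finset.mem_filter.mp h).2.1)
      (convexHull_mono (Finset.coe_subset.mpr hΔP) (hΔhull hxX)) hτP hr
      (fun z hz => hon z (Finset.mem_of_mem_erase hz))
      (fun z hz => hempty z (hPq hz)) (hon x hxτ).le
  refine ⟨σ, x, ⟨((γ w).1, (γ y).2), Finset.mem_image_of_mem (fun z => (γ z).1) hwX,
    Finset.mem_image_of_mem (fun z => (γ z).2) (hτX hyτ),
    ⟨Finset.card_pos.mp (by omega), hσP, c', r', hr', hσon, hσempty⟩, hσcard,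
    ⟨c', r', hr', hσon, hxσ⟩,
    Or.inl ⟨(γ x).1, Finset.mem_image_of_mem (fun z => (γ z).1) hxX, hwx, ?_,
      Finset.mem_filter.mpr ⟨hxX, le_rfl, hmax2 x hxτ⟩⟩⟩, Finset.subset_insert_iff.mpr hτσ⟩
  intro b hb hwb
  obtain ⟨z, hz, rfl⟩ := Finset.mem_image.mp hb
  exact not_lt.mp fun h => hwb.not_ge (hpred z hz h)
end
end

section
/- Let Z ⊆ ℝ^d be a finite point set in general position, let z ∈ Z, and let N_z = {z} ∪ {y ∈ Z : {z,y} ∈ DelT(Z)} be the Delaunay neighborhood of z. Then for every Y with N_z ⊆ Y ⊆ Z, the star of z is the same in both triangulations: {σ ∈ DelT(N_z) : z ∈ σ} = {σ ∈ DelT(Y) : z ∈ σ}. -/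
noncomputable section

attribute [local instance] Classical.propDecidable

variable {d : ℕ}

/-- The bisector inequality for a point on the segment from `z` to `c`. -/
theorem norm_sub_lineMap_le_iff (z c w : Pt d) (t : ℝ) :
    ‖z - (z + t • (c - z))‖ ≤ ‖w - (z + t • (c - z))‖ ↔
      2 * t * inner ℝ (c - z) (w - z) ≤ ‖w - z‖ ^ 2 := by
  have hleft : ‖z - (z + t • (c - z))‖ = ‖t • (c - z)‖ := by
    rw [← norm_neg (t • (c - z))]
    congr 1
    abel
  have hright : w - (z + t • (c - z)) = (w - z) - t • (c - z) := by abel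
  rw [← sq_le_sq₀ (norm_nonneg _) (norm_nonneg _), hleft, hright, norm_sub_sq_real,
    real_inner_smul_right, real_inner_comm]
  constructor <;> intro h <;> linarith

/-- A pair is a Delaunay edge as soon as some point is equidistant from its endpoints and no
farther from them than from any other point. -/
theorem pair_mem_delT {Z : Finset (Pt d)} {z y c : Pt d} (hz : z ∈ Z) (hy : y ∈ Z)
    (hyc : ‖y - c‖ = ‖z - c‖) (hc : ∀ w ∈ Z, ‖z - c‖ ≤ ‖w - c‖) :
    ({z, y} : Finset (Pt d)) ∈ DelT Z := by
  refine ⟨⟨z, by simp⟩, ?_, c, ‖z - c‖, norm_nonneg _, ?_, fun w hw => (hc w hw).not_gt⟩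
  · intro w hw
    rcases Finset.mem_insert.1 hw with rfl | hw
    · exact hz
    · rwa [Finset.mem_singleton.1 hw]
  · intro w hw
    rcases Finset.mem_insert.1 hw with rfl | hw
    · rfl
    · rwa [Finset.mem_singleton.1 hw]

/-- The Voronoi cell of `z` is already cut out by the Delaunay neighbors of `z`. -/
theorem norm_sub_le_of_forall_delaunay_neighbor {Z : Finset (Pt d)} {z c : Pt d} (hz : z ∈ Z)
    (hc : ∀ y ∈ Z, ({z, y} : Finset (Pt d)) ∈ DelT Z → ‖z - c‖ ≤ ‖y - c‖) :
    ∀ w ∈ Z, ‖z - c‖ ≤ ‖w - c‖ := by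
  have hiff : ∀ w, ‖z - c‖ ≤ ‖w - c‖ ↔ 2 * inner ℝ (c - z) (w - z) ≤ ‖w - z‖ ^ 2 := by
    intro w
    simpa using norm_sub_lineMap_le_iff z c w 1
  by_contra! hbad
  obtain ⟨w₀, hw₀, hlt₀⟩ := hbad
  let B := Z.filter fun w => ‖w - c‖ < ‖z - c‖
  obtain ⟨y, hyB, hmin⟩ := B.exists_min_image
    (fun w => ‖w - z‖ ^ 2 / (2 * inner ℝ (c - z) (w - z))) ⟨w₀, Finset.mem_filter.2 ⟨hw₀, hlt₀⟩⟩
  have hBpos : ∀ w ∈ B, ‖w - z‖ ^ 2 < 2 * inner ℝ (c - z) (w - z) := fun w hw =>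
    not_le.1 (mt (hiff w).2 (Finset.mem_filter.1 hw).2.not_ge)
  obtain ⟨hyZ, hylt⟩ := Finset.mem_filter.1 hyB
  have hy := hBpos y hyB
  have hpos : 0 < 2 * inner ℝ (c - z) (y - z) := (sq_nonneg _).trans_lt hy
  set t := ‖y - z‖ ^ 2 / (2 * inner ℝ (c - z) (y - z)) with ht
  have ht0 : 0 ≤ t := by positivity
  have ht1 : t ≤ 1 := (div_le_one hpos).2 hy.le
  have hty : t * (2 * inner ℝ (c - z) (y - z)) = ‖y - z‖ ^ 2 := div_mul_cancel₀ _ hpos.ne'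
  have hcell : ∀ w ∈ Z, ‖z - (z + t • (c - z))‖ ≤ ‖w - (z + t • (c - z))‖ := by
    intro w hw
    rw [norm_sub_lineMap_le_iff]
    by_cases hwB : w ∈ B
    · have hw' := (le_div_iff₀ ((sq_nonneg _).trans_lt (hBpos w hwB))).1 (hmin w hwB)
      linarith
    · have hle : 2 * inner ℝ (c - z) (w - z) ≤ ‖w - z‖ ^ 2 :=
        (hiff w).1 (not_lt.1 fun h => hwB (Finset.mem_filter.2 ⟨hw, h⟩))
      nlinarith [mul_le_mul_of_nonneg_left hle ht0,
        mul_le_mul_of_nonneg_right ht1 (sq_nonneg ‖w - z‖)]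
  have heq : ‖y - (z + t • (c - z))‖ = ‖z - (z + t • (c - z))‖ := by
    refine le_antisymm ?_ (hcell y hyZ)
    have hright : y - (z + t • (c - z)) = (y - z) - t • (c - z) := by abel
    have hleft : z - (z + t • (c - z)) = -(t • (c - z)) := by abel
    rw [← sq_le_sq₀ (norm_nonneg _) (norm_nonneg _), hleft, hright, norm_neg, norm_sub_sq_real,
      real_inner_smul_right, real_inner_comm]
    linarith
  exact hylt.not_ge (hc y hyZ (pair_mem_delT hz hyZ heq hcell))

/-- Locality of Delaunay triangulations: for `N_z ⊆ Y ⊆ Z`, the star of `z` in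
`DelT(N_z)` equals the star of `z` in `DelT(Y)`. -/
theorem localStarStar
    {d : ℕ} (hd : 1 ≤ d) (Z : Finset (Pt d)) (hgen : GenPos Z)
    (z : Pt d) (hz : z ∈ Z)
    (N : Finset (Pt d))
    (hN : N = insert z (Z.filter fun y => ({z, y} : Finset (Pt d)) ∈ DelT Z))
    (Y : Finset (Pt d)) (hNY : N ⊆ Y) (hYZ : Y ⊆ Z) :
    {σ : Finset (Pt d) | σ ∈ DelT N ∧ z ∈ σ} = {σ : Finset (Pt d) | σ ∈ DelT Y ∧ z ∈ σ} := by
  subst hN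
  have hcellZ : ∀ c, (∀ w ∈ insert z (Z.filter fun y => ({z, y} : Finset (Pt d)) ∈ DelT Z),
      ‖z - c‖ ≤ ‖w - c‖) → ∀ w ∈ Z, ‖z - c‖ ≤ ‖w - c‖ := fun c hc =>
    norm_sub_le_of_forall_delaunay_neighbor hz fun y hy hzy =>
      hc y (Finset.mem_insert_of_mem (Finset.mem_filter.2 ⟨hy, hzy⟩))
  ext σ
  constructor
  · rintro ⟨⟨hne, hsub, c, r, hr, hon, hemp⟩, hzσ⟩
    obtain rfl := hon z hzσ
    exact ⟨⟨hne, hsub.trans hNY, c, _, hr, hon, fun w hw =>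
      (hcellZ c (fun y hy => not_lt.1 (hemp y hy)) w (hYZ hw)).not_gt⟩, hzσ⟩
  · rintro ⟨⟨hne, hsub, c, r, hr, hon, hemp⟩, hzσ⟩
    obtain rfl := hon z hzσ
    have hZ := hcellZ c fun y hy => not_lt.1 (hemp y (hNY hy))
    exact ⟨⟨hne, fun w hw => Finset.mem_insert_of_mem (Finset.mem_filter.2
      ⟨hYZ (hsub hw), pair_mem_delT hz (hYZ (hsub hw)) (hon w hw) hZ⟩), c, _, hr, hon,
      fun w hw => hemp w (hNY hw)⟩, hzσ⟩
end
end
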